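/- Let B be a trivial brace (a skew brace in which the two operations coincide and are abelian) such that the group (B,+) is finitely generated. Then B is finitely presented as a skew brace. -/

import Mathlib

universe u v

/-- A skew (left) brace: two group structures `(B,+)` and `(B,∘)` on the same set,
sharing the same identity element `zero` (recall that in any skew brace `0 = 1`),
satisfying the skew left distributive law `a ∘ (b + c) = a ∘ b - a + a ∘ c`. -/
structure SkewBrace (B : Type u) where
  add : B → B → B
  zero : B
  neg : B → B
  mul : B → B → B
  inv : B → B
  add_assoc : ∀ a b c, add (add a b) c = add a (add b c)
  zero_add : ∀ a, add zero a = a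
  add_zero : ∀ a, add a zero = a
  neg_add : ∀ a, add (neg a) a = zero
  add_neg : ∀ a, add a (neg a) = zero
  mul_assoc : ∀ a b c, mul (mul a b) c = mul a (mul b c)
  zero_mul : ∀ a, mul zero a = a
  mul_zero : ∀ a, mul a zero = a
  inv_mul : ∀ a, mul (inv a) a = zero
  mul_inv : ∀ a, mul a (inv a) = zero
  compat : ∀ a b c, mul a (add b c) = add (add (mul a b) (neg a)) (mul a c)

namespace SkewBrace

variable {B C Q : Type u}

/-- `λ_a (b) = -a + a ∘ b`. -/
def lam (S : SkewBrace B) (a b : B) : B := S.add (S.neg a) (S.mul a b)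

/-- `a ∗ b = λ_a(b) - b = -a + a ∘ b - b`. -/
def star (S : SkewBrace B) (a b : B) : B := S.add (S.lam a b) (S.neg b)

/-- A sub-skew brace: a subset containing the identity and closed under both group
operations and both inverses. -/
def IsSub (S : SkewBrace B) (T : Set B) : Prop :=
  S.zero ∈ T ∧ (∀ a ∈ T, ∀ b ∈ T, S.add a b ∈ T) ∧ (∀ a ∈ T, S.neg a ∈ T) ∧
    (∀ a ∈ T, ∀ b ∈ T, S.mul a b ∈ T) ∧ (∀ a ∈ T, S.inv a ∈ T)

/-- The sub-skew brace generated by a subset. -/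
def subGen (S : SkewBrace B) (X : Set B) : Set B := ⋂₀ {T | S.IsSub T ∧ X ⊆ T}

/-- A skew brace is finitely generated if a finite subset generates it. -/
def FinitelyGenerated (S : SkewBrace B) : Prop := ∃ T : Finset B, S.subGen ↑T = Set.univ

/-- A subgroup of the additive group `(B,+)`. -/
def IsAddSubgroup (S : SkewBrace B) (T : Set B) : Prop :=
  S.zero ∈ T ∧ (∀ a ∈ T, ∀ b ∈ T, S.add a b ∈ T) ∧ ∀ a ∈ T, S.neg a ∈ T

/-- A subgroup of the multiplicative group `(B,∘)`. -/
def IsMulSubgroup (S : SkewBrace B) (T : Set B) : Prop :=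
  S.zero ∈ T ∧ (∀ a ∈ T, ∀ b ∈ T, S.mul a b ∈ T) ∧ ∀ a ∈ T, S.inv a ∈ T

/-- The additive subgroup generated by a subset. -/
def addClosure (S : SkewBrace B) (X : Set B) : Set B := ⋂₀ {T | S.IsAddSubgroup T ∧ X ⊆ T}

/-- The multiplicative subgroup generated by a subset. -/
def mulClosure (S : SkewBrace B) (X : Set B) : Set B := ⋂₀ {T | S.IsMulSubgroup T ∧ X ⊆ T}

/-- The group `(B,+)` is finitely generated. -/
def AddFG (S : SkewBrace B) : Prop := ∃ T : Finset B, S.addClosure ↑T = Set.univ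

/-- The group `(B,∘)` is finitely generated. -/
def MulFG (S : SkewBrace B) : Prop := ∃ T : Finset B, S.mulClosure ↑T = Set.univ

/-- An ideal of a skew brace: a subgroup of `(B,+)`, normal in `(B,+)` and in `(B,∘)`,
invariant under all the maps `λ_b`. -/
def IsIdeal (S : SkewBrace B) (I : Set B) : Prop :=
  S.IsAddSubgroup I ∧ (∀ b : B, ∀ a ∈ I, S.add (S.add b a) (S.neg b) ∈ I) ∧
    (∀ b : B, ∀ a ∈ I, S.mul (S.mul b a) (S.inv b) ∈ I) ∧
    ∀ b : B, ∀ a ∈ I, S.lam b a ∈ I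

/-- The ideal generated by a subset (the smallest ideal containing it). -/
def idealGen (S : SkewBrace B) (X : Set B) : Set B := ⋂₀ {I | S.IsIdeal I ∧ X ⊆ I}

/-- A homomorphism of skew braces. -/
def IsHom (S : SkewBrace B) (T : SkewBrace C) (f : B → C) : Prop :=
  (∀ a b, f (S.add a b) = T.add (f a) (f b)) ∧ ∀ a b, f (S.mul a b) = T.mul (f a) (f b)

/-- `SF` together with `ι : X → F` is the free skew brace on `X`: every map from `X`
to a skew brace extends uniquely to a homomorphism. -/
def IsFreeOn {F : Type u} {X : Type v} (SF : SkewBrace F) (ι : X → F) : Prop :=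
  ∀ (C : Type u) (SC : SkewBrace C) (f : X → C),
    ∃! g : F → C, IsHom SF SC g ∧ ∀ x, g (ι x) = f x

/-- A skew brace is finitely presented if it is the image of a free skew brace on a
finite set under a homomorphism whose kernel is generated, as an ideal, by finitely
many elements. -/
def FinitelyPresented (S : SkewBrace B) : Prop :=
  ∃ (F : Type u) (SF : SkewBrace F) (m : ℕ) (ι : Fin m → F) (θ : F → B),
    IsFreeOn SF ι ∧ IsHom SF S θ ∧ Function.Surjective θ ∧
      ∃ R : Finset F, {x | θ x = S.zero} = SF.idealGen ↑R

/-- `π : B → Q` realizes `Q` as the quotient skew brace `B/I`. -/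
def IsQuotientBy (S : SkewBrace B) (I : Set B) (SQ : SkewBrace Q) (π : B → Q) : Prop :=
  IsHom S SQ π ∧ Function.Surjective π ∧ {x | π x = SQ.zero} = I

/-- The group `(B,+)` is finitely presented (as an abstract group). -/
def AddFP (S : SkewBrace B) : Prop :=
  ∃ (m : ℕ) (f : FreeGroup (Fin m) → B),
    (∀ x y, f (x * y) = S.add (f x) (f y)) ∧ Function.Surjective f ∧
      ∃ R : Finset (FreeGroup (Fin m)),
        {x | f x = S.zero} = ↑(Subgroup.normalClosure (R : Set (FreeGroup (Fin m))))

/-- The group `(B,∘)` is finitely presented (as an abstract group). -/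
def MulFP (S : SkewBrace B) : Prop :=
  ∃ (m : ℕ) (f : FreeGroup (Fin m) → B),
    (∀ x y, f (x * y) = S.mul (f x) (f y)) ∧ Function.Surjective f ∧
      ∃ R : Finset (FreeGroup (Fin m)),
        {x | f x = S.zero} = ↑(Subgroup.normalClosure (R : Set (FreeGroup (Fin m))))

/-- The ascending chain condition on sub-skew braces. -/
def SubACC (S : SkewBrace B) : Prop :=
  ∀ f : ℕ → Set B, Monotone f → (∀ n, S.IsSub (f n)) → ∃ n, ∀ m, n ≤ m → f m = f n

/-- The ascending chain condition on subgroups of `(B,+)`. -/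
def AddACC (S : SkewBrace B) : Prop :=
  ∀ f : ℕ → Set B, Monotone f → (∀ n, S.IsAddSubgroup (f n)) → ∃ n, ∀ m, n ≤ m → f m = f n

/-- The socle `Soc(B) = Ker(λ) ∩ Z(B,+)`. -/
def soc (S : SkewBrace B) : Set B :=
  {x | (∀ b, S.lam x b = b) ∧ ∀ b, S.add x b = S.add b x}

/-- The centre of the additive group `(B,+)`. -/
def addCenter (S : SkewBrace B) : Set B := {x | ∀ b, S.add x b = S.add b x}

/-- The preimage in `B` of `Ann(B/I)` (for `I` an ideal): the set of `x` such that,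
modulo `I`, `λ_x = id`, `x` is central in `(B,+)` and `x` is central in `(B,∘)`. -/
def annStep (S : SkewBrace B) (I : Set B) : Set B :=
  {x | (∀ b, S.add (S.lam x b) (S.neg b) ∈ I) ∧
       (∀ b, S.add (S.add x b) (S.neg (S.add b x)) ∈ I) ∧
       ∀ b, S.mul (S.mul x b) (S.inv (S.mul b x)) ∈ I}

/-- The preimage in `B` of `Soc(B/I)` (for `I` an ideal). -/
def socStep (S : SkewBrace B) (I : Set B) : Set B :=
  {x | (∀ b, S.add (S.lam x b) (S.neg b) ∈ I) ∧
       ∀ b, S.add (S.add x b) (S.neg (S.add b x)) ∈ I}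

/-- The upper annihilator series `Ann_α(B)`, defined by transfinite recursion. -/
noncomputable def annSeries (S : SkewBrace B) (o : Ordinal.{v}) : Set B :=
  Ordinal.limitRecOn o {S.zero} (fun _ ih => S.annStep ih)
    fun _o _ ih => ⋃ β, ⋃ h : β < _o, ih β h

/-- The upper socle series `Soc_α(B)`, defined by transfinite recursion. -/
noncomputable def socSeries (S : SkewBrace B) (o : Ordinal.{v}) : Set B :=
  Ordinal.limitRecOn o {S.zero} (fun _ ih => S.socStep ih)
    fun _o _ ih => ⋃ β, ⋃ h : β < _o, ih β h

/-- The solution of the YBE associated with a skew brace: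
`r_B(a,b) = (λ_a(b), λ_a(b)⁻¹ ∘ a ∘ b)`. -/
def braceR (S : SkewBrace B) : B × B → B × B :=
  fun p => (S.lam p.1 p.2, S.mul (S.inv (S.lam p.1 p.2)) (S.mul p.1 p.2))

end SkewBrace

/-- The set-theoretic Yang–Baxter (braid) equation
`(r × id)(id × r)(r × id) = (id × r)(r × id)(id × r)`. -/
def ybe {X : Type u} (r : X × X → X × X) : Prop :=
  let r₁ : X × X × X → X × X × X := fun p =>
    ((r (p.1, p.2.1)).1, (r (p.1, p.2.1)).2, p.2.2)
  let r₂ : X × X × X → X × X × X := fun p => (p.1, r p.2)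
  r₁ ∘ r₂ ∘ r₁ = r₂ ∘ r₁ ∘ r₂

/-- A non-degenerate set-theoretic solution: `r` is bijective, satisfies the YBE, and
writing `r (x,y) = (σ_x y, τ_y x)`, all maps `σ_x` and `τ_y` are bijective. -/
def IsNonDegenerateSolution {X : Type u} (r : X × X → X × X) : Prop :=
  Function.Bijective r ∧ ybe r ∧
    (∀ x, Function.Bijective fun y => (r (x, y)).1) ∧
    ∀ y, Function.Bijective fun x => (r (x, y)).2

/-- `S` (with the distinguished map `ι : X → B`) is the structure skew brace of the
solution `(X,r)`: the multiplicative group of `S` is the structure group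
`G(X,r) = ⟨X | x y = σ_x(y) τ_y(x)⟩` (expressed by the relations holding together
with the universal property of the presentation) and `r_S ∘ (ι × ι) = (ι × ι) ∘ r`. -/
def IsStructureSkewBrace {X B : Type u} (r : X × X → X × X)
    (S : SkewBrace B) (ι : X → B) : Prop :=
  (∀ x y, S.mul (ι x) (ι y) = S.mul (ι (r (x, y)).1) (ι (r (x, y)).2)) ∧
  (∀ (H : Type u) [Group H] (f : X → H),
      (∀ x y, f x * f y = f (r (x, y)).1 * f (r (x, y)).2) →
      ∃! φ : B → H, (∀ a b, φ (S.mul a b) = φ a * φ b) ∧ ∀ x, φ (ι x) = f x) ∧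
  ∀ x y, S.braceR (ι x, ι y) = (ι (r (x, y)).1, ι (r (x, y)).2)

namespace SkewBrace

variable {B C Q : Type u}

/-- The additive group of a skew brace. -/
abbrev addGroup (S : SkewBrace B) : AddGroup B :=
  letI : Add B := ⟨S.add⟩
  letI : Zero B := ⟨S.zero⟩
  letI : Neg B := ⟨S.neg⟩
  AddGroup.ofLeftAxioms S.add_assoc S.zero_add S.neg_add

theorem neg_add_cancel_left (S : SkewBrace B) (a b : B) : S.add (S.neg a) (S.add a b) = b := by
  rw [← S.add_assoc, S.neg_add, S.zero_add]

theorem add_neg_cancel_left (S : SkewBrace B) (a b : B) : S.add a (S.add (S.neg a) b) = b := by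
  rw [← S.add_assoc, S.add_neg, S.zero_add]

theorem inv_mul_cancel_left (S : SkewBrace B) (a b : B) : S.mul (S.inv a) (S.mul a b) = b := by
  rw [← S.mul_assoc, S.inv_mul, S.zero_mul]

theorem mul_inv_cancel_left (S : SkewBrace B) (a b : B) : S.mul a (S.mul (S.inv a) b) = b := by
  rw [← S.mul_assoc, S.mul_inv, S.zero_mul]

theorem neg_zero (S : SkewBrace B) : S.neg S.zero = S.zero := by
  rw [← S.add_zero (S.neg S.zero), S.neg_add]

theorem inv_zero (S : SkewBrace B) : S.inv S.zero = S.zero := by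
  rw [← S.mul_zero (S.inv S.zero), S.inv_mul]

theorem eq_neg_of_add_eq_zero (S : SkewBrace B) {a b : B} (h : S.add a b = S.zero) :
    b = S.neg a := by
  rw [← S.neg_add_cancel_left a b, h, S.add_zero]

theorem eq_inv_of_mul_eq_zero (S : SkewBrace B) {a b : B} (h : S.mul a b = S.zero) :
    b = S.inv a := by
  rw [← S.inv_mul_cancel_left a b, h, S.mul_zero]

theorem eq_of_add_neg_eq_zero (S : SkewBrace B) {a b : B} (h : S.add a (S.neg b) = S.zero) :
    a = b := by
  rw [← S.add_zero a, ← S.neg_add b, ← S.add_assoc, h, S.zero_add]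

theorem mul_add (S : SkewBrace B) (a b c : B) :
    S.mul a (S.add b c) = S.add (S.mul a b) (S.lam a c) := by
  rw [S.compat, S.add_assoc, lam]

theorem mul_eq_add_lam (S : SkewBrace B) (a b : B) : S.mul a b = S.add a (S.lam a b) := by
  rw [lam, S.add_neg_cancel_left]

theorem add_eq_mul_lam_inv (S : SkewBrace B) (a b : B) :
    S.add a b = S.mul a (S.lam (S.inv a) b) := by
  have h : S.mul a (S.neg (S.inv a)) = S.add a a := by
    have h' := S.compat a (S.inv a) (S.neg (S.inv a))
    rw [S.add_neg, S.mul_zero, S.mul_inv, S.zero_add] at h'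
    rw [← S.add_neg_cancel_left a (S.mul a _), ← h']
  rw [lam, S.compat, h, S.mul_inv_cancel_left, S.add_assoc a a, S.add_neg, S.add_zero]

theorem lam_add (S : SkewBrace B) (a b c : B) :
    S.lam a (S.add b c) = S.add (S.lam a b) (S.lam a c) := by
  rw [lam, S.mul_add, ← S.add_assoc, ← lam]

namespace IsHom

variable {S : SkewBrace B} {T : SkewBrace C} {U : SkewBrace Q} {f : B → C} {g : C → Q}

theorem map_zero (h : IsHom S T f) : f S.zero = T.zero := by
  rw [← T.neg_add_cancel_left (f S.zero) (f S.zero), ← h.1, S.add_zero, T.neg_add]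

theorem map_neg (h : IsHom S T f) (a : B) : f (S.neg a) = T.neg (f a) :=
  T.eq_neg_of_add_eq_zero (by rw [← h.1, S.add_neg, h.map_zero])

theorem map_inv (h : IsHom S T f) (a : B) : f (S.inv a) = T.inv (f a) :=
  T.eq_inv_of_mul_eq_zero (by rw [← h.2, S.mul_inv, h.map_zero])

theorem comp (hg : IsHom T U g) (hf : IsHom S T f) : IsHom S U (g ∘ f) :=
  ⟨fun a b => by simp only [Function.comp, hf.1, hg.1],
    fun a b => by simp only [Function.comp, hf.2, hg.2]⟩

theorem isIdeal_ker (h : IsHom S T f) : S.IsIdeal {x | f x = T.zero} := by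
  refine ⟨⟨h.map_zero, fun a ha b hb => ?_, fun a ha => ?_⟩, fun b a ha => ?_, fun b a ha => ?_,
    fun b a ha => ?_⟩ <;> simp only [Set.mem_ofPred_eq] at *
  · rw [h.1, ha, hb, T.add_zero]
  · rw [h.map_neg, ha, T.neg_zero]
  · rw [h.1, h.1, h.map_neg, ha, T.add_zero, T.add_neg]
  · rw [h.2, h.2, h.map_inv, ha, T.mul_zero, T.mul_inv]
  · rw [lam, h.1, h.2, h.map_neg, ha, T.mul_zero, T.neg_add]

end IsHom

section Quotient

variable {S : SkewBrace B} {I : Set B}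

/-- Congruence modulo an ideal. -/
def IsIdeal.setoid (hI : S.IsIdeal I) : Setoid B where
  r a b := ∃ i ∈ I, S.add a i = b
  iseqv :=
    { refl := fun a => ⟨_, hI.1.1, S.add_zero a⟩
      symm := by
        rintro a _ ⟨i, hi, rfl⟩
        exact ⟨_, hI.1.2.2 i hi, by rw [S.add_assoc, S.add_neg, S.add_zero]⟩
      trans := by
        rintro a _ _ ⟨i, hi, rfl⟩ ⟨j, hj, rfl⟩
        exact ⟨_, hI.1.2.1 i hi j hj, (S.add_assoc a i j).symm⟩ }

theorem IsIdeal.add_congr (hI : S.IsIdeal I) {a a' b b' : B} (ha : hI.setoid.r a a')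
    (hb : hI.setoid.r b b') : hI.setoid.r (S.add a b) (S.add a' b') := by
  obtain ⟨i, hi, rfl⟩ := ha
  obtain ⟨j, hj, rfl⟩ := hb
  have hc : S.add (S.add (S.neg b) i) b ∈ I := by
    have := hI.2.1 (S.neg b) i hi
    rwa [← S.eq_neg_of_add_eq_zero (S.neg_add b)] at this
  exact ⟨_, hI.1.2.1 _ hc j hj, by simp only [S.add_assoc, S.add_neg_cancel_left]⟩

theorem IsIdeal.mul_congr (hI : S.IsIdeal I) {a a' b b' : B} (ha : hI.setoid.r a a')
    (hb : hI.setoid.r b b') : hI.setoid.r (S.mul a b) (S.mul a' b') := by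
  obtain ⟨i, hi, rfl⟩ := ha
  obtain ⟨j, hj, rfl⟩ := hb
  have hi' := hI.2.2.2 (S.inv a) i hi
  rw [S.add_eq_mul_lam_inv a i, S.mul_add]
  have hc : S.mul (S.mul (S.inv b) (S.lam (S.inv a) i)) b ∈ I := by
    have := hI.2.2.1 (S.inv b) _ hi'
    rwa [← S.eq_inv_of_mul_eq_zero (S.inv_mul b)] at this
  refine ⟨_, hI.1.2.1 _ (hI.2.2.2 (S.mul a b) _ hc) _ (hI.2.2.2 (S.mul a (S.lam (S.inv a) i)) j hj), ?_⟩
  rw [← S.add_assoc, ← S.mul_eq_add_lam]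
  simp only [S.mul_assoc, S.mul_inv_cancel_left]

theorem IsIdeal.neg_congr (hI : S.IsIdeal I) {a a' : B} (ha : hI.setoid.r a a') :
    hI.setoid.r (S.neg a) (S.neg a') := by
  have h := hI.add_congr (hI.add_congr (hI.setoid.refl (S.neg a)) (hI.setoid.symm ha))
    (hI.setoid.refl (S.neg a'))
  rw [S.neg_add, S.zero_add, S.add_assoc, S.add_neg, S.add_zero] at h
  exact h

theorem IsIdeal.inv_congr (hI : S.IsIdeal I) {a a' : B} (ha : hI.setoid.r a a') :
    hI.setoid.r (S.inv a) (S.inv a') := by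
  have h := hI.mul_congr (hI.mul_congr (hI.setoid.refl (S.inv a)) (hI.setoid.symm ha))
    (hI.setoid.refl (S.inv a'))
  rw [S.inv_mul, S.zero_mul, S.mul_assoc, S.mul_inv, S.mul_zero] at h
  exact h

/-- The quotient of a skew brace by an ideal. -/
def IsIdeal.quotient (hI : S.IsIdeal I) : SkewBrace (Quotient hI.setoid) where
  add := Quotient.map₂ S.add fun _ _ h _ _ h' => hI.add_congr h h'
  zero := Quotient.mk _ S.zero
  neg := Quotient.map S.neg fun _ _ h => hI.neg_congr h
  mul := Quotient.map₂ S.mul fun _ _ h _ _ h' => hI.mul_congr h h'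
  inv := Quotient.map S.inv fun _ _ h => hI.inv_congr h
  add_assoc := by rintro ⟨a⟩ ⟨b⟩ ⟨c⟩; exact congrArg (Quotient.mk _) (S.add_assoc a b c)
  zero_add := by rintro ⟨a⟩; exact congrArg (Quotient.mk _) (S.zero_add a)
  add_zero := by rintro ⟨a⟩; exact congrArg (Quotient.mk _) (S.add_zero a)
  neg_add := by rintro ⟨a⟩; exact congrArg (Quotient.mk _) (S.neg_add a)
  add_neg := by rintro ⟨a⟩; exact congrArg (Quotient.mk _) (S.add_neg a)
  mul_assoc := by rintro ⟨a⟩ ⟨b⟩ ⟨c⟩; exact congrArg (Quotient.mk _) (S.mul_assoc a b c)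
  zero_mul := by rintro ⟨a⟩; exact congrArg (Quotient.mk _) (S.zero_mul a)
  mul_zero := by rintro ⟨a⟩; exact congrArg (Quotient.mk _) (S.mul_zero a)
  inv_mul := by rintro ⟨a⟩; exact congrArg (Quotient.mk _) (S.inv_mul a)
  mul_inv := by rintro ⟨a⟩; exact congrArg (Quotient.mk _) (S.mul_inv a)
  compat := by rintro ⟨a⟩ ⟨b⟩ ⟨c⟩; exact congrArg (Quotient.mk _) (S.compat a b c)

theorem IsIdeal.isHom_mk (hI : S.IsIdeal I) : IsHom S hI.quotient (Quotient.mk hI.setoid) :=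
  ⟨fun _ _ => rfl, fun _ _ => rfl⟩

theorem IsIdeal.mk_eq_zero_iff (hI : S.IsIdeal I) {a : B} :
    Quotient.mk hI.setoid a = hI.quotient.zero ↔ a ∈ I := by
  refine Iff.trans ⟨fun h => hI.setoid.symm (Quotient.exact h),
    fun h => Quotient.sound (hI.setoid.symm h)⟩ ⟨?_, fun h => ⟨a, h, S.zero_add a⟩⟩
  rintro ⟨i, hi, rfl⟩
  rwa [S.zero_add]

end Quotient

section Free

/-- Terms in the language of skew braces with variables in `X`. -/
inductive Term (X : Type u) : Type u
  | of (x : X) : Term X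
  | zero : Term X
  | add (s t : Term X) : Term X
  | neg (t : Term X) : Term X
  | mul (s t : Term X) : Term X
  | inv (t : Term X) : Term X

variable {X : Type u}

/-- Evaluation of a term in a skew brace. -/
def Term.eval (S : SkewBrace B) (f : X → B) : Term X → B
  | of x => f x
  | zero => S.zero
  | add s t => S.add (s.eval S f) (t.eval S f)
  | neg t => S.neg (t.eval S f)
  | mul s t => S.mul (s.eval S f) (t.eval S f)
  | inv t => S.inv (t.eval S f)

/-- Two terms are identified when they agree under every evaluation in a skew brace. -/
def Term.setoid (X : Type u) : Setoid (Term X) where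
  r s t := ∀ (B : Type u) (S : SkewBrace B) (f : X → B), s.eval S f = t.eval S f
  iseqv :=
    { refl := fun _ _ _ _ => rfl
      symm := fun h B S f => (h B S f).symm
      trans := fun h h' B S f => (h B S f).trans (h' B S f) }

/-- The free skew brace on `X`. -/
def free (X : Type u) : SkewBrace (Quotient (Term.setoid X)) where
  add := Quotient.map₂ Term.add fun _ _ h _ _ h' B S f =>
    congrArg₂ S.add (h B S f) (h' B S f)
  zero := Quotient.mk _ Term.zero
  neg := Quotient.map Term.neg fun _ _ h B S f => congrArg S.neg (h B S f)
  mul := Quotient.map₂ Term.mul fun _ _ h _ _ h' B S f =>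
    congrArg₂ S.mul (h B S f) (h' B S f)
  inv := Quotient.map Term.inv fun _ _ h B S f => congrArg S.inv (h B S f)
  add_assoc := by rintro ⟨a⟩ ⟨b⟩ ⟨c⟩; exact Quotient.sound fun _ S _ => S.add_assoc _ _ _
  zero_add := by rintro ⟨a⟩; exact Quotient.sound fun _ S _ => S.zero_add _
  add_zero := by rintro ⟨a⟩; exact Quotient.sound fun _ S _ => S.add_zero _
  neg_add := by rintro ⟨a⟩; exact Quotient.sound fun _ S _ => S.neg_add _
  add_neg := by rintro ⟨a⟩; exact Quotient.sound fun _ S _ => S.add_neg _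
  mul_assoc := by rintro ⟨a⟩ ⟨b⟩ ⟨c⟩; exact Quotient.sound fun _ S _ => S.mul_assoc _ _ _
  zero_mul := by rintro ⟨a⟩; exact Quotient.sound fun _ S _ => S.zero_mul _
  mul_zero := by rintro ⟨a⟩; exact Quotient.sound fun _ S _ => S.mul_zero _
  inv_mul := by rintro ⟨a⟩; exact Quotient.sound fun _ S _ => S.inv_mul _
  mul_inv := by rintro ⟨a⟩; exact Quotient.sound fun _ S _ => S.mul_inv _
  compat := by rintro ⟨a⟩ ⟨b⟩ ⟨c⟩; exact Quotient.sound fun _ S _ => S.compat _ _ _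

/-- The canonical generators of the free skew brace. -/
def freeOf (x : X) : Quotient (Term.setoid X) := Quotient.mk _ (Term.of x)

theorem IsSub.eq_univ_of_freeOf_mem {T : Set (Quotient (Term.setoid X))} (hT : (free X).IsSub T)
    (h : ∀ x, freeOf x ∈ T) (y : Quotient (Term.setoid X)) : y ∈ T := by
  obtain ⟨t, rfl⟩ := Quotient.exists_rep y
  induction t with
  | of x => exact h x
  | zero => exact hT.1
  | add s t hs ht => exact hT.2.1 _ hs _ ht
  | neg t ht => exact hT.2.2.1 _ ht
  | mul s t hs ht => exact hT.2.2.2.1 _ hs _ ht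
  | inv t ht => exact hT.2.2.2.2 _ ht

theorem isFreeOn_freeOf (X : Type u) : IsFreeOn (free X) (freeOf : X → _) := by
  intro C SC f
  refine ⟨Quotient.lift (Term.eval SC f) fun _ _ h => h C SC f, ⟨⟨?_, ?_⟩, fun _ => rfl⟩, ?_⟩
  · rintro ⟨a⟩ ⟨b⟩; rfl
  · rintro ⟨a⟩ ⟨b⟩; rfl
  · rintro g ⟨hg, hgf⟩
    funext y
    obtain ⟨t, rfl⟩ := Quotient.exists_rep y
    change _ = t.eval SC f
    induction t with
    | of x => exact hgf x
    | zero => exact hg.map_zero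
    | add s t hs ht => exact (hg.1 _ _).trans (congrArg₂ SC.add hs ht)
    | neg t ht => exact (hg.map_neg _).trans (congrArg SC.neg ht)
    | mul s t hs ht => exact (hg.2 _ _).trans (congrArg₂ SC.mul hs ht)
    | inv t ht => exact (hg.map_inv _).trans (congrArg SC.inv ht)

theorem IsFreeOn.comp_equiv {F : Type u} {Y : Type v} {SF : SkewBrace F} {ι : X → F}
    (h : IsFreeOn SF ι) (e : Y ≃ X) : IsFreeOn SF (ι ∘ e) := by
  intro C SC f
  obtain ⟨g, ⟨hg, hgf⟩, hu⟩ := h C SC (f ∘ e.symm)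
  refine ⟨g, ⟨hg, fun y => by simp [hgf]⟩, fun g' ⟨hg', hgf'⟩ => hu g' ⟨hg', fun x => ?_⟩⟩
  simpa using hgf' (e.symm x)

end Free

section Trivial

theorem isAddSubgroup_addClosure (S : SkewBrace B) (X : Set B) :
    S.IsAddSubgroup (S.addClosure X) :=
  ⟨fun _ hT => hT.1.1, fun a ha b hb T hT => hT.1.2.1 a (ha T hT) b (hb T hT),
    fun a ha T hT => hT.1.2.2 a (ha T hT)⟩

theorem subset_addClosure (S : SkewBrace B) (X : Set B) : X ⊆ S.addClosure X :=
  fun _ hx _ hT => hT.2 hx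

theorem addClosure_subset (S : SkewBrace B) {X T : Set B} (hT : S.IsAddSubgroup T) (h : X ⊆ T) :
    S.addClosure X ⊆ T :=
  fun _ hx => hx T ⟨hT, h⟩

theorem isAddSubgroup_centralizer (S : SkewBrace B) (Y : Set B) :
    S.IsAddSubgroup {x | ∀ y ∈ Y, S.add x y = S.add y x} := by
  refine ⟨fun y _ => by rw [S.zero_add, S.add_zero], fun a ha b hb y hy => ?_, fun a ha y hy => ?_⟩
  · rw [S.add_assoc, hb y hy, ← S.add_assoc, ha y hy, S.add_assoc]
  · let _ := S.addGroup
    have h : AddCommute a y := ha y hy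
    exact h.neg_left

theorem isAddSubgroup_lam_fixed (S : SkewBrace B) (a : B) :
    S.IsAddSubgroup {b | S.lam a b = b} := by
  have h0 : S.lam a S.zero = S.zero := by rw [lam, S.mul_zero, S.neg_add]
  refine ⟨h0, fun b hb c hc => ?_, fun b hb => ?_⟩ <;> simp only [Set.mem_ofPred_eq] at *
  · rw [S.lam_add, hb, hc]
  · apply S.eq_neg_of_add_eq_zero
    nth_rw 1 [← hb]
    rw [← S.lam_add, S.add_neg, h0]

theorem add_comm_of_mem_addClosure (S : SkewBrace B) {X : Set B}
    (h : ∀ x ∈ X, ∀ y ∈ X, S.add x y = S.add y x) {a b : B} (ha : a ∈ S.addClosure X)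
    (hb : b ∈ S.addClosure X) : S.add a b = S.add b a := by
  have h' : ∀ x ∈ S.addClosure X, ∀ y ∈ X, S.add x y = S.add y x := fun x hx =>
    S.addClosure_subset (S.isAddSubgroup_centralizer X) h hx
  exact (S.addClosure_subset (S.isAddSubgroup_centralizer (S.addClosure X))
    (fun y hy x hx => (h' x hx y hy).symm) ha) b hb

theorem mul_eq_add_of_mem_addClosure (S : SkewBrace B) {X : Set B}
    (h : ∀ x ∈ X, ∀ y ∈ X, S.mul x y = S.add x y) {a b : B} (ha : a ∈ S.addClosure X)
    (hb : b ∈ S.addClosure X) : S.mul a b = S.add a b := by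
  have hA := S.isAddSubgroup_addClosure X
  have hT : S.IsAddSubgroup
      {a | a ∈ S.addClosure X ∧ ∀ b ∈ S.addClosure X, S.mul a b = S.add a b} := by
    refine ⟨⟨hA.1, fun b _ => by rw [S.zero_add, S.zero_mul]⟩, ?_, ?_⟩
    · rintro a ⟨ha, ha'⟩ c ⟨hc, hc'⟩
      refine ⟨hA.2.1 a ha c hc, fun b hb => ?_⟩
      rw [← ha' c hc, S.mul_assoc, hc' b hb, ha' _ (hA.2.1 c hc b hb), ha' c hc, S.add_assoc]
    · rintro a ⟨ha, ha'⟩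
      have hn := hA.2.2 a ha
      refine ⟨hn, fun b hb => ?_⟩
      have hinv : S.neg a = S.inv a := S.eq_inv_of_mul_eq_zero (by rw [ha' _ hn, S.add_neg])
      have hb' := ha' _ (hA.2.1 _ hn b hb)
      rw [S.add_neg_cancel_left] at hb'
      conv_lhs => rw [hinv, ← hb', S.inv_mul_cancel_left]
  refine (S.addClosure_subset hT (fun x hx => ⟨S.subset_addClosure X hx, fun b hb => ?_⟩) ha).2 b hb
  have hfix : S.lam x b = b := S.addClosure_subset (S.isAddSubgroup_lam_fixed x)
    (fun y hy => by
      change S.lam x y = y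
      rw [lam, h x hx y hy, S.neg_add_cancel_left]) hb
  rw [S.mul_eq_add_lam, hfix]

theorem isSub_addClosure (S : SkewBrace B) {X : Set B}
    (h : ∀ x ∈ X, ∀ y ∈ X, S.mul x y = S.add x y) : S.IsSub (S.addClosure X) := by
  have hA := S.isAddSubgroup_addClosure X
  refine ⟨hA.1, hA.2.1, hA.2.2, fun a ha b hb => ?_, fun a ha => ?_⟩
  · rw [S.mul_eq_add_of_mem_addClosure h ha hb]
    exact hA.2.1 a ha b hb
  · have hn := hA.2.2 a ha
    rwa [S.eq_inv_of_mul_eq_zero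
      (by rw [S.mul_eq_add_of_mem_addClosure h ha hn, S.add_neg] :
        S.mul a (S.neg a) = S.zero)] at hn

theorem IsSub.preimage {S : SkewBrace B} {T : SkewBrace C} {f : B → C} (hf : IsHom S T f)
    {A : Set C} (hA : T.IsSub A) : S.IsSub (f ⁻¹' A) := by
  refine ⟨?_, fun a ha b hb => ?_, fun a ha => ?_, fun a ha b hb => ?_, fun a ha => ?_⟩ <;>
    simp only [Set.mem_preimage, hf.map_zero, hf.1, hf.2, hf.map_neg, hf.map_inv] at *
  · exact hA.1
  · exact hA.2.1 _ ha _ hb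
  · exact hA.2.2.1 _ ha
  · exact hA.2.2.2.1 _ ha _ hb
  · exact hA.2.2.2.2 _ ha

/-- The trivial skew brace on an abelian group. -/
def ofAddCommGroup (A : Type u) [AddCommGroup A] : SkewBrace A where
  add a b := a + b
  zero := 0
  neg a := -a
  mul a b := a + b
  inv a := -a
  add_assoc := _root_.add_assoc
  zero_add := _root_.zero_add
  add_zero := _root_.add_zero
  neg_add := neg_add_cancel
  add_neg := add_neg_cancel
  mul_assoc := _root_.add_assoc
  zero_mul := _root_.zero_add
  mul_zero := _root_.add_zero
  inv_mul := neg_add_cancel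
  mul_inv := add_neg_cancel
  compat a b c := by abel

/-- In a trivial brace, the linear map determined by a family of elements, as a homomorphism of
skew braces. -/
theorem exists_isHom_finsupp (S : SkewBrace B) (htriv : ∀ a b, S.mul a b = S.add a b)
    (hcomm : ∀ a b, S.add a b = S.add b a) {X : Type u} (f : X → B) :
    ∃ p : (X →₀ ℤ) → B, IsHom (ofAddCommGroup (X →₀ ℤ)) S p ∧
      ∀ x, p (Finsupp.single x 1) = f x := by
  let _ : AddCommGroup B := { S.addGroup with add_comm := hcomm }
  refine ⟨Finsupp.linearCombination ℤ f, ⟨fun a b => map_add _ a b, fun a b => ?_⟩, fun x => ?_⟩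
  · rw [htriv]; exact map_add _ a b
  · simp

theorem IsHom.ker_finsupp_fg {S : SkewBrace B} {X : Type u} [Finite X] {p : (X →₀ ℤ) → B}
    (hp : IsHom (ofAddCommGroup (X →₀ ℤ)) S p) :
    ∃ K : Finset (X →₀ ℤ),
      {n | p n = S.zero} = (AddSubgroup.closure (K : Set (X →₀ ℤ)) : Set (X →₀ ℤ)) := by
  let _ := S.addGroup
  let φ : (X →₀ ℤ) →+ B := ⟨⟨p, hp.map_zero⟩, hp.1⟩
  obtain ⟨K, hK⟩ := IsNoetherian.noetherian (AddSubgroup.toIntSubmodule φ.ker)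
  have hK' := congrArg Submodule.toAddSubgroup hK
  rw [Submodule.span_int_eq_addSubgroupClosure] at hK'
  exact ⟨K, by rw [hK']; rfl⟩

theorem isAddSubgroup_range {S : SkewBrace B} {T : SkewBrace C} {f : B → C} (hf : IsHom S T f) :
    T.IsAddSubgroup (Set.range f) := by
  refine ⟨⟨_, hf.map_zero⟩, ?_, ?_⟩
  · rintro _ ⟨a, rfl⟩ _ ⟨b, rfl⟩
    exact ⟨_, hf.1 a b⟩
  · rintro _ ⟨a, rfl⟩
    exact ⟨_, hf.map_neg a⟩

end Trivial

end SkewBrace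

open SkewBrace

/-- **Corollary.** Let `B` be a trivial brace (the two operations coincide and are
abelian) whose group `(B,+)` is finitely generated. Then `B` is finitely presented
as a skew brace. -/
theorem trivial_brace_finitely_presented {B : Type u} (S : SkewBrace B)
    (htriv : ∀ a b, S.mul a b = S.add a b)
    (hconm : ∀ a b, S.add a b = S.add b a)
    (hfg : S.AddFG) :
    S.FinitelyPresented := by
  classical
  obtain ⟨T, hT⟩ := hfg
  let ι : T → Quotient (Term.setoid T) := freeOf
  have hfree : IsFreeOn (free T) ι := isFreeOn_freeOf T
  obtain ⟨θ, ⟨hθ, hθι⟩, hθu⟩ := hfree B S (fun x => x)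
  obtain ⟨ab, ⟨hab, habι⟩, -⟩ :=
    hfree (T →₀ ℤ) (ofAddCommGroup _) (fun x => Finsupp.single x 1)
  obtain ⟨p, hp, hpι⟩ := S.exists_isHom_finsupp htriv hconm (fun x : T => (x : B))
  obtain ⟨K, hK⟩ := hp.ker_finsupp_fg
  have hθp : p ∘ ab = θ :=
    hθu _ ⟨hp.comp hab, fun x => by simp only [Function.comp, habι, hpι]⟩
  have hθs : Function.Surjective θ := fun b =>
    S.addClosure_subset (isAddSubgroup_range hθ) (fun x hx => ⟨ι ⟨x, hx⟩, hθι _⟩)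
      (hT ▸ Set.mem_univ b)
  have habs : Function.Surjective ab := by
    intro n
    have hr := isAddSubgroup_range hab
    induction n using Finsupp.induction_linear with
    | zero => exact hr.1
    | add f g hf hg => exact hr.2.1 _ hf _ hg
    | single x k =>
      let A : AddSubgroup (T →₀ ℤ) :=
        { carrier := Set.range ab
          zero_mem' := hr.1
          add_mem' := fun ha hb => hr.2.1 _ ha _ hb
          neg_mem' := fun ha => hr.2.2 _ ha }
      have h : k • Finsupp.single x (1 : ℤ) ∈ A := A.zsmul_mem ⟨ι x, habι x⟩ k
      rwa [Finsupp.smul_single, smul_eq_mul, _root_.mul_one] at h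
  choose w hw using habs
  let F := free T
  let R : Finset (Quotient (Term.setoid T)) :=
    (Finset.univ.image fun xy : T × T =>
      F.add (F.add (ι xy.1) (ι xy.2)) (F.neg (F.add (ι xy.2) (ι xy.1)))) ∪
    (Finset.univ.image fun xy : T × T =>
      F.add (F.mul (ι xy.1) (ι xy.2)) (F.neg (F.add (ι xy.1) (ι xy.2)))) ∪ K.image w
  refine ⟨_, F, _, ι ∘ (Fintype.equivFin T).symm, θ, hfree.comp_equiv _, hθ, hθs, R, ?_⟩
  apply Set.Subset.antisymm
  · rintro y hy J ⟨hJ, hRJ⟩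
    let π := Quotient.mk hJ.setoid
    have hπ : IsHom F hJ.quotient π := hJ.isHom_mk
    have hπR : ∀ r ∈ R, π r = hJ.quotient.zero := fun r hr => hJ.mk_eq_zero_iff.2 (hRJ hr)
    let X := Set.range (π ∘ ι)
    have hXc : ∀ a ∈ X, ∀ b ∈ X, hJ.quotient.add a b = hJ.quotient.add b a := by
      rintro _ ⟨a, rfl⟩ _ ⟨b, rfl⟩
      apply hJ.quotient.eq_of_add_neg_eq_zero
      simp only [Function.comp, ← hπ.1, ← hπ.map_neg]
      exact hπR _ (Finset.mem_union_left _ (Finset.mem_union_left _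
        (Finset.mem_image.2 ⟨(a, b), Finset.mem_univ _, rfl⟩)))
    have hXm : ∀ a ∈ X, ∀ b ∈ X, hJ.quotient.mul a b = hJ.quotient.add a b := by
      rintro _ ⟨a, rfl⟩ _ ⟨b, rfl⟩
      apply hJ.quotient.eq_of_add_neg_eq_zero
      simp only [Function.comp, ← hπ.1, ← hπ.2, ← hπ.map_neg]
      exact hπR _ (Finset.mem_union_left _ (Finset.mem_union_right _
        (Finset.mem_image.2 ⟨(a, b), Finset.mem_univ _, rfl⟩)))
    have hgen : ∀ q, q ∈ hJ.quotient.addClosure X := by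
      intro q
      obtain ⟨z, rfl⟩ := Quotient.exists_rep q
      exact ((hJ.quotient.isSub_addClosure hXm).preimage hπ).eq_univ_of_freeOf_mem
        (fun x => hJ.quotient.subset_addClosure X ⟨x, rfl⟩) z
    obtain ⟨g, hg, hgι⟩ := hJ.quotient.exists_isHom_finsupp
      (fun a b => hJ.quotient.mul_eq_add_of_mem_addClosure hXm (hgen a) (hgen b))
      (fun a b => hJ.quotient.add_comm_of_mem_addClosure hXc (hgen a) (hgen b)) (π ∘ ι)
    have hgπ : g ∘ ab = π := (hfree _ hJ.quotient (π ∘ ι)).unique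
      ⟨hg.comp hab, fun x => by simp only [Function.comp, habι, hgι]⟩ ⟨hπ, fun _ => rfl⟩
    have hgK : ∀ n ∈ AddSubgroup.closure (K : Set (T →₀ ℤ)), g n = hJ.quotient.zero := by
      intro n hn
      have hker := hg.isIdeal_ker.1
      induction hn using AddSubgroup.closure_induction with
      | mem k hk =>
        rw [← hw k, ← Function.comp_apply (f := g), hgπ]
        exact hπR _ (Finset.mem_union_right _ (Finset.mem_image_of_mem w hk))
      | zero => exact hker.1
      | add a b _ _ ha hb => exact hker.2.1 _ ha _ hb
      | neg a _ ha => exact hker.2.2 _ ha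
    refine hJ.mk_eq_zero_iff.1 (?_ : π y = _)
    rw [← hgπ]
    refine hgK _ (hK.subset ?_)
    change (p ∘ ab) y = S.zero
    rw [hθp]
    exact hy
  · refine fun y hy => hy _ ⟨hθ.isIdeal_ker, fun r hr => ?_⟩
    change θ r = S.zero
    simp only [R, Finset.mem_coe, Finset.mem_union, Finset.mem_image] at hr
    obtain (⟨⟨a, b⟩, -, rfl⟩ | ⟨⟨a, b⟩, -, rfl⟩) | ⟨k, hk, rfl⟩ := hr
    · rw [hθ.1, hθ.map_neg, hθ.1, hθ.1, hconm (θ (ι a)), S.add_neg]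
    · rw [hθ.1, hθ.map_neg, hθ.1, hθ.2, htriv, S.add_neg]
    · rw [← hθp, Function.comp_apply, hw]
      exact hK.superset (AddSubgroup.subset_closure hk)
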